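/- arXiv:2605.24741 — 5 statements merged into one kernel-verified Lean document; each statement's English description precedes it below -/
import Mathlib

section
/- There exists a universal constant C > 0 such that for every nonempty finite set X, all distributions p, q on X, and every ε with 0 < ε ≤ d_TV(p,q)/4: n*_TV(p,q,ε/2) ≤ C·n*_Hub(p,q,ε) and n*_Hub(p,q,ε) ≤ C·n*_TV(p,q,ε). -/
open scoped Classical ENNReal
open Finset

noncomputable section

/-- A probability distribution on a finite set. -/
def IsDist {X : Type*} [Fintype X] (p : X → ℝ) : Prop :=
  (∀ x, 0 ≤ p x) ∧ ∑ x, p x = 1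

/-- Total variation distance. -/
def dTV {X : Type*} [Fintype X] (p q : X → ℝ) : ℝ :=
  (1 / 2) * ∑ x, |p x - q x|

/-- Squared Hellinger divergence (also for unnormalized nonnegative vectors). -/
def hellSq {X : Type*} [Fintype X] (p q : X → ℝ) : ℝ :=
  ∑ x, (Real.sqrt (p x) - Real.sqrt (q x)) ^ 2

/-- ε-Huber uncertainty set. -/
def PHub {X : Type*} [Fintype X] (p : X → ℝ) (ε : ℝ) : Set (X → ℝ) :=
  {p' | IsDist p' ∧ ∀ x, (1 - ε) * p x ≤ p' x}

/-- ε-TV uncertainty set. -/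
def PTV {X : Type*} [Fintype X] (p : X → ℝ) (ε : ℝ) : Set (X → ℝ) :=
  {p' | IsDist p' ∧ dTV p' p ≤ ε}

/-- ε-subtractive uncertainty set. -/
def PSub {X : Type*} [Fintype X] (p : X → ℝ) (ε : ℝ) : Set (X → ℝ) :=
  {p' | IsDist p' ∧ ∀ x, p' x ≤ (1 + ε) * p x}

/-- Sum of worst-case type-I and type-II errors of a randomized test `φ` on `n`
i.i.d. samples, for composite hypotheses `Pcal` vs `Qcal`. -/
def errSum {X : Type*} [Fintype X] (Pcal Qcal : Set (X → ℝ)) (n : ℕ)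
    (φ : (Fin n → X) → ℝ) : ℝ :=
  (⨆ P : Pcal, ∑ x : Fin n → X, (∏ i, (P : X → ℝ) (x i)) * φ x) +
  (⨆ Q : Qcal, ∑ x : Fin n → X, (∏ i, (Q : X → ℝ) (x i)) * (1 - φ x))

/-- Minimax `n`-sample error for testing `Pcal` against `Qcal`. -/
def eStar {X : Type*} [Fintype X] (Pcal Qcal : Set (X → ℝ)) (n : ℕ) : ℝ :=
  ⨅ φ : {φ : (Fin n → X) → ℝ // ∀ x, 0 ≤ φ x ∧ φ x ≤ 1}, errSum Pcal Qcal n φ.1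

/-- Sample complexity: the least `n` with minimax error at most `1/10` (`⊤` if none). -/
def nStar {X : Type*} [Fintype X] (Pcal Qcal : Set (X → ℝ)) : ℝ≥0∞ :=
  sInf {N : ℝ≥0∞ | ∃ n : ℕ, N = (n : ℝ≥0∞) ∧ eStar Pcal Qcal n ≤ 1 / 10}

/-- Hellinger affinity (Bhattacharyya coefficient) of two nonnegative vectors. -/
def affinity {X : Type*} [Fintype X] (p q : X → ℝ) : ℝ :=
  ∑ x, Real.sqrt (p x * q x)

section

variable {X : Type*} [Fintype X]

lemma affinity_nonneg (p q : X → ℝ) : 0 ≤ affinity p q :=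
  Finset.sum_nonneg fun _ _ => Real.sqrt_nonneg _

lemma affinity_comm (p q : X → ℝ) : affinity p q = affinity q p := by
  simp only [affinity, mul_comm]

lemma affinity_le_one {p q : X → ℝ} (hp : IsDist p) (hq : IsDist q) : affinity p q ≤ 1 := by
  calc affinity p q ≤ ∑ x, (p x + q x) / 2 := by
        refine Finset.sum_le_sum fun x _ => ?_
        rw [Real.sqrt_le_left (by linarith [hp.1 x, hq.1 x])]
        nlinarith [sq_nonneg (p x - q x)]
    _ = 1 := by
        rw [← Finset.sum_div, Finset.sum_add_distrib, hp.2, hq.2]; norm_num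

/-- The `n`-fold product of a distribution is a distribution. -/
lemma isDist_prod {p : X → ℝ} (hp : IsDist p) (n : ℕ) :
    IsDist fun x : Fin n → X => ∏ i, p (x i) := by
  refine ⟨fun x => Finset.prod_nonneg fun i _ => hp.1 _, ?_⟩
  rw [← Fintype.sum_pow, hp.2, one_pow]

lemma affinity_prod {p q : X → ℝ} (hp : IsDist p) (hq : IsDist q) (n : ℕ) :
    affinity (fun x : Fin n → X => ∏ i, p (x i)) (fun x => ∏ i, q (x i)) = affinity p q ^ n := by
  unfold affinity
  rw [Fintype.sum_pow]
  refine Finset.sum_congr rfl fun x _ => ?_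
  rw [← Finset.prod_mul_distrib,
    Real.sqrt_prod _ fun i _ => mul_nonneg (hp.1 _) (hq.1 _)]

/-- Le Cam's inequality: the error of any test between `p` and `q` is at least half the squared
affinity. -/
lemma affinity_sq_le_error {p q φ : X → ℝ} (hp : IsDist p) (hq : IsDist q)
    (hφ : ∀ x, 0 ≤ φ x ∧ φ x ≤ 1) :
    affinity p q ^ 2 / 2 ≤ ∑ x, p x * φ x + ∑ x, q x * (1 - φ x) := by
  have hmin : ∑ x, min (p x) (q x) ≤ ∑ x, p x * φ x + ∑ x, q x * (1 - φ x) := by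
    rw [← Finset.sum_add_distrib]
    refine Finset.sum_le_sum fun x _ => ?_
    nlinarith [mul_le_mul_of_nonneg_right (min_le_left (p x) (q x)) (hφ x).1,
      mul_le_mul_of_nonneg_right (min_le_right (p x) (q x)) (sub_nonneg.2 (hφ x).2)]
  have hmax : ∑ x, max (p x) (q x) ≤ 2 := by
    calc ∑ x, max (p x) (q x) ≤ ∑ x, (p x + q x) :=
          Finset.sum_le_sum fun x _ =>
            max_le (by linarith [hq.1 x]) (by linarith [hp.1 x])
      _ = 2 := by rw [Finset.sum_add_distrib, hp.2, hq.2]; norm_num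
  have hcs : affinity p q ^ 2 ≤ (∑ x, min (p x) (q x)) * ∑ x, max (p x) (q x) := by
    refine Finset.sum_sq_le_sum_mul_sum_of_sq_le_mul _
      (fun x _ => le_min (hp.1 x) (hq.1 x)) (fun x _ => le_max_of_le_left (hp.1 x)) fun x _ => ?_
    rw [Real.sq_sqrt (mul_nonneg (hp.1 x) (hq.1 x)), min_mul_max]
  have h0 : 0 ≤ ∑ x, min (p x) (q x) :=
    Finset.sum_nonneg fun x _ => le_min (hp.1 x) (hq.1 x)
  nlinarith [mul_le_mul_of_nonneg_left hmax h0]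

lemma sum_mul_le_one {p φ : X → ℝ} (hp : IsDist p) (hφ : ∀ x, φ x ≤ 1) :
    ∑ x, p x * φ x ≤ 1 :=
  hp.2 ▸ Finset.sum_le_sum fun x _ => mul_le_of_le_one_right (hp.1 x) (hφ x)

lemma bddAbove_error {S : Set (X → ℝ)} (hS : ∀ p ∈ S, IsDist p) {n : ℕ}
    {φ : (Fin n → X) → ℝ} (hφ : ∀ x, φ x ≤ 1) :
    BddAbove (Set.range fun P : S => ∑ x : Fin n → X, (∏ i, (P : X → ℝ) (x i)) * φ x) := by
  refine ⟨1, ?_⟩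
  rintro _ ⟨P, rfl⟩
  exact sum_mul_le_one (isDist_prod (hS P P.2) n) hφ

lemma iSup_error_nonneg {S : Set (X → ℝ)} (hS : ∀ p ∈ S, IsDist p) {n : ℕ}
    {φ : (Fin n → X) → ℝ} (hφ : ∀ x, 0 ≤ φ x) :
    0 ≤ ⨆ P : S, ∑ x : Fin n → X, (∏ i, (P : X → ℝ) (x i)) * φ x :=
  Real.iSup_nonneg fun P => Finset.sum_nonneg fun x _ =>
    mul_nonneg ((isDist_prod (hS P P.2) n).1 x) (hφ x)

lemma eStar_le_errSum {S T : Set (X → ℝ)} (hS : ∀ p ∈ S, IsDist p) (hT : ∀ q ∈ T, IsDist q)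
    {n : ℕ} {φ : (Fin n → X) → ℝ} (hφ : ∀ x, 0 ≤ φ x ∧ φ x ≤ 1) :
    eStar S T n ≤ errSum S T n φ := by
  refine ciInf_le (f := fun φ : {φ : (Fin n → X) → ℝ // ∀ x, 0 ≤ φ x ∧ φ x ≤ 1} =>
    errSum S T n φ.1) ⟨0, ?_⟩ ⟨φ, hφ⟩
  rintro _ ⟨ψ, rfl⟩
  exact add_nonneg (iSup_error_nonneg hS fun x => (ψ.2 x).1)
    (iSup_error_nonneg hT fun x => sub_nonneg.2 (ψ.2 x).2)

lemma nonempty_tests (Y : Type*) :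
    Nonempty {φ : Y → ℝ // ∀ x, 0 ≤ φ x ∧ φ x ≤ 1} :=
  ⟨⟨fun _ => 0, fun _ => ⟨le_rfl, zero_le_one⟩⟩⟩

lemma eStar_mono {S T S' T' : Set (X → ℝ)} (hS : S.Nonempty) (hT : T.Nonempty)
    (hSS' : S ⊆ S') (hTT' : T ⊆ T') (hS' : ∀ p ∈ S', IsDist p) (hT' : ∀ q ∈ T', IsDist q)
    (n : ℕ) : eStar S T n ≤ eStar S' T' n := by
  have := nonempty_tests (Fin n → X)
  have := hS.to_subtype
  have := hT.to_subtype
  refine le_ciInf fun φ => (eStar_le_errSum (fun p hp => hS' p (hSS' hp))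
    (fun q hq => hT' q (hTT' hq)) φ.2).trans (add_le_add ?_ ?_)
  · exact ciSup_le fun P => le_ciSup
      (f := fun P : S' => ∑ x : Fin n → X, (∏ i, (P : X → ℝ) (x i)) * φ.1 x)
      (bddAbove_error hS' fun x => (φ.2 x).2) ⟨P, hSS' P.2⟩
  · exact ciSup_le fun Q => le_ciSup
      (f := fun Q : T' => ∑ x : Fin n → X, (∏ i, (Q : X → ℝ) (x i)) * (1 - φ.1 x))
      (bddAbove_error hT' fun x => sub_le_self _ (φ.2 x).1) ⟨Q, hTT' Q.2⟩

lemma affinity_pow_le_eStar {S T : Set (X → ℝ)} (hS : ∀ p ∈ S, IsDist p)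
    (hT : ∀ q ∈ T, IsDist q) {p q : X → ℝ} (hp : p ∈ S) (hq : q ∈ T) (n : ℕ) :
    affinity p q ^ (2 * n) / 2 ≤ eStar S T n := by
  have := nonempty_tests (Fin n → X)
  refine le_ciInf fun φ => ?_
  have h := affinity_sq_le_error (isDist_prod (hS p hp) n) (isDist_prod (hT q hq) n) φ.2
  rw [affinity_prod (hS p hp) (hT q hq), ← pow_mul, mul_comm n] at h
  refine h.trans (add_le_add ?_ ?_)
  · exact le_ciSup (f := fun P : S => ∑ x : Fin n → X, (∏ i, (P : X → ℝ) (x i)) * φ.1 x)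
      (bddAbove_error hS fun x => (φ.2 x).2) ⟨p, hp⟩
  · exact le_ciSup (f := fun Q : T => ∑ x : Fin n → X, (∏ i, (Q : X → ℝ) (x i)) * (1 - φ.1 x))
      (bddAbove_error hT fun x => sub_le_self _ (φ.2 x).1) ⟨q, hq⟩

lemma nStar_le_mul {S T S' T' : Set (X → ℝ)} {k : ℕ} (hk : k ≠ 0)
    (h : ∀ n, eStar S T n ≤ 1 / 10 → eStar S' T' (k * n) ≤ 1 / 10) :
    nStar S' T' ≤ k * nStar S T := by
  rw [mul_comm, ← ENNReal.div_le_iff (by exact_mod_cast hk) (ENNReal.natCast_ne_top k)]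
  refine le_sInf ?_
  rintro _ ⟨n, rfl, hn⟩
  refine ENNReal.div_le_of_le_mul (sInf_le ⟨k * n, ?_, h n hn⟩)
  push_cast
  ring

/-- The test thresholding `∏ f (x i)` at `1` has error at most `r ^ n` under each hypothesis, where
`r` bounds the means of `f` under `S` and of `1 / f` under `T`. -/
lemma eStar_le_of_weights {S T : Set (X → ℝ)} (hS : ∀ p ∈ S, IsDist p) (hT : ∀ q ∈ T, IsDist q)
    {f g : X → ℝ} (hf : ∀ x, 0 ≤ f x) (hg : ∀ x, 0 ≤ g x) (hfg : ∀ x, f x * g x = 1)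
    {r : ℝ} (hr : 0 ≤ r) (hfr : ∀ p ∈ S, ∑ x, p x * f x ≤ r)
    (hgr : ∀ q ∈ T, ∑ x, q x * g x ≤ r) (n : ℕ) : eStar S T n ≤ r ^ n + r ^ n := by
  have bound : ∀ {U : Set (X → ℝ)} {w : X → ℝ} {ψ : (Fin n → X) → ℝ},
      (∀ p ∈ U, IsDist p) → (∀ x, 0 ≤ w x) → (∀ p ∈ U, ∑ x, p x * w x ≤ r) →
      (∀ x, ψ x ≤ ∏ i, w (x i)) →
      ⨆ P : U, ∑ x : Fin n → X, (∏ i, (P : X → ℝ) (x i)) * ψ x ≤ r ^ n := by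
    intro U w ψ hU hw hwr hψ
    refine Real.iSup_le (fun P => ?_) (pow_nonneg hr n)
    calc ∑ x : Fin n → X, (∏ i, (P : X → ℝ) (x i)) * ψ x
        ≤ ∑ x : Fin n → X, ∏ i, ((P : X → ℝ) (x i) * w (x i)) := by
          refine Finset.sum_le_sum fun x _ => ?_
          rw [Finset.prod_mul_distrib]
          exact mul_le_mul_of_nonneg_left (hψ x) ((isDist_prod (hU P P.2) n).1 x)
      _ = (∑ x, (P : X → ℝ) x * w x) ^ n := (Fintype.sum_pow (fun x => (P : X → ℝ) x * w x) n).symm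
      _ ≤ r ^ n := pow_le_pow_left₀
          (Finset.sum_nonneg fun x _ => mul_nonneg ((hU P P.2).1 x) (hw x)) (hwr P P.2) n
  let φ : (Fin n → X) → ℝ := fun x => if 1 ≤ ∏ i, f (x i) then 1 else 0
  have hφ : ∀ x, 0 ≤ φ x ∧ φ x ≤ 1 := fun x => by
    by_cases h : 1 ≤ ∏ i, f (x i) <;> simp [φ, h]
  refine (eStar_le_errSum hS hT hφ).trans (add_le_add (bound hS hf hfr ?_) (bound hT hg hgr ?_))
  · intro x
    by_cases h : 1 ≤ ∏ i, f (x i)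
    · simp [φ, h]
    · simpa [φ, h] using Finset.prod_nonneg fun i _ => hf (x i)
  · intro x
    have hg0 : 0 ≤ ∏ i, g (x i) := Finset.prod_nonneg fun i _ => hg (x i)
    by_cases h : 1 ≤ ∏ i, f (x i)
    · simpa [φ, h] using hg0
    · have h1 : (∏ i, f (x i)) * ∏ i, g (x i) = 1 := by
        rw [← Finset.prod_mul_distrib]
        exact Finset.prod_eq_one fun i _ => hfg (x i)
      simp only [φ, h, if_false, sub_zero]
      nlinarith

lemma sqrt_one_add_ge {u : ℝ} (hu : -1 ≤ u) : 1 + u / 2 - u ^ 2 / 2 ≤ Real.sqrt (1 + u) := by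
  have hs := Real.sqrt_nonneg (1 + u)
  have hsq : Real.sqrt (1 + u) ^ 2 = 1 + u := Real.sq_sqrt (by linarith)
  generalize Real.sqrt (1 + u) = s at hs hsq ⊢
  obtain rfl : u = s ^ 2 - 1 := by linarith
  nlinarith [mul_nonneg (mul_nonneg hs (sq_nonneg (s - 1))) (show 0 ≤ s + 2 by linarith)]

/-- First-order optimality condition for the affinity in its first argument. -/
lemma sum_weight_le_of_isMax {a a' b : X → ℝ} (ha : ∀ x, 0 < a x) (ha' : ∀ x, 0 < a' x)
    (hb : ∀ x, 0 ≤ b x)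
    (hmax : ∀ t : ℝ, 0 ≤ t → t ≤ 1 →
      affinity (fun x => a x + t * (a' x - a x)) b ≤ affinity a b) :
    ∑ x, a' x * (Real.sqrt (a x * b x) / a x) ≤ affinity a b := by
  let w : X → ℝ := fun x => Real.sqrt (a x * b x) / a x
  let D := ∑ x, (a' x - a x) * w x
  let K := ∑ x, (a' x - a x) ^ 2 * w x / a x
  have hK : 0 ≤ K := Finset.sum_nonneg fun x _ =>
    div_nonneg (mul_nonneg (sq_nonneg _) (div_nonneg (Real.sqrt_nonneg _) (ha x).le)) (ha x).le
  have key : ∀ t : ℝ, 0 < t → t ≤ 1 → D ≤ t * K := by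
    intro t ht ht1
    have h : affinity a b + t * D / 2 - t ^ 2 * K / 2 ≤ affinity a b := by
      refine le_trans ?_ (hmax t ht.le ht1)
      simp only [affinity, D, K, Finset.mul_sum, Finset.sum_div, ← Finset.sum_add_distrib,
        ← Finset.sum_sub_distrib]
      refine Finset.sum_le_sum fun x _ => ?_
      have hax := ha x
      have hu : -1 ≤ t * (a' x - a x) / a x := by
        rw [le_div_iff₀ hax]
        nlinarith [mul_nonneg ht.le (ha' x).le, mul_nonneg (sub_nonneg.2 ht1) hax.le]
      have e : (a x + t * (a' x - a x)) * b x =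
          (a x * b x) * (1 + t * (a' x - a x) / a x) := by
        field_simp
      rw [e, Real.sqrt_mul (mul_nonneg hax.le (hb x))]
      refine le_trans (le_of_eq ?_)
        (mul_le_mul_of_nonneg_left (sqrt_one_add_ge hu) (Real.sqrt_nonneg _))
      simp only [w]
      field_simp
    have : t * D ≤ t * (t * K) := by nlinarith
    exact le_of_mul_le_mul_left this ht
  have hD : D ≤ 0 := by
    by_contra! hD
    have ht : 0 < min 1 (D / (2 * (K + 1))) := lt_min one_pos (by positivity)
    have h1 := key _ ht (min_le_left _ _)
    have h2 := mul_le_mul_of_nonneg_right (min_le_right 1 (D / (2 * (K + 1)))) hK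
    have h3 : D / (2 * (K + 1)) * K < D := by
      rw [div_mul_eq_mul_div, div_lt_iff₀ (by positivity)]
      nlinarith
    linarith
  have hsum : ∑ x, a' x * w x = D + affinity a b := by
    simp only [D, affinity, ← Finset.sum_add_distrib]
    refine Finset.sum_congr rfl fun x _ => ?_
    have hax := (ha x).ne'
    simp only [w]
    field_simp
    ring
  linarith

lemma affinity_add_const_le {p q : X → ℝ} (hp : IsDist p) (hq : IsDist q) {δ : ℝ} (hδ : 0 ≤ δ) :
    affinity (fun x => p x + δ) (fun x => q x + δ) ≤
      affinity p q + Fintype.card X * Real.sqrt (δ * (2 + δ)) := by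
  have h1 : ∀ {r : X → ℝ}, IsDist r → ∀ x, r x ≤ 1 := fun {r} hr x =>
    hr.2 ▸ Finset.single_le_sum (fun y _ => hr.1 y) (Finset.mem_univ x)
  have : (Fintype.card X : ℝ) * Real.sqrt (δ * (2 + δ)) =
      ∑ _x : X, Real.sqrt (δ * (2 + δ)) := by simp
  rw [this]
  unfold affinity
  rw [← Finset.sum_add_distrib]
  refine Finset.sum_le_sum fun x _ => ?_
  have hs := Real.sq_sqrt (mul_nonneg (hp.1 x) (hq.1 x))
  have hs' := Real.sq_sqrt (show 0 ≤ δ * (2 + δ) by positivity)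
  have hm := mul_nonneg (Real.sqrt_nonneg (p x * q x)) (Real.sqrt_nonneg (δ * (2 + δ)))
  refine Real.sqrt_le_iff.2 ⟨by positivity, ?_⟩
  nlinarith [h1 hp x, h1 hq x]

/-- Compact convex families whose pairwise affinities are at most `r` can be tested from `n`
samples with error arbitrarily close to `2 * r ^ n`. -/
lemma eStar_le_of_affinity_le {S T : Set (X → ℝ)} (hS : ∀ p ∈ S, IsDist p)
    (hT : ∀ q ∈ T, IsDist q) (hSc : IsCompact S) (hTc : IsCompact T) (hSv : Convex ℝ S)
    (hTv : Convex ℝ T) (hSn : S.Nonempty) (hTn : T.Nonempty) {r : ℝ}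
    (h : ∀ p ∈ S, ∀ q ∈ T, affinity p q ≤ r) (n : ℕ) {e : ℝ} (he : r ^ n + r ^ n < e) :
    eStar S T n ≤ e := by
  obtain ⟨δ, hδ, hδe⟩ : ∃ δ : ℝ, 0 < δ ∧
      (r + Fintype.card X * Real.sqrt (δ * (2 + δ))) ^ n +
      (r + Fintype.card X * Real.sqrt (δ * (2 + δ))) ^ n < e := by
    have hc : Continuous fun δ : ℝ => (r + Fintype.card X * Real.sqrt (δ * (2 + δ))) ^ n +
        (r + Fintype.card X * Real.sqrt (δ * (2 + δ))) ^ n := by fun_prop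
    have hev := (hc.tendsto 0).eventually_lt_const (u := e) (by simpa using he)
    obtain ⟨δ, h1, h2⟩ := ((hev.filter_mono nhdsWithin_le_nhds).and
      (self_mem_nhdsWithin (a := (0 : ℝ)) (s := Set.Ioi 0))).exists
    exact ⟨δ, h2, h1⟩
  obtain ⟨⟨P, Q⟩, ⟨hP, hQ⟩, hmax⟩ := (hSc.prod hTc).exists_isMaxOn (hSn.prod hTn)
    (f := fun z : (X → ℝ) × (X → ℝ) => affinity (fun x => z.1 x + δ) (fun x => z.2 x + δ))
    (by unfold affinity; fun_prop)
  have hpos : ∀ {R : X → ℝ}, IsDist R → ∀ x, 0 < R x + δ := fun hR x => by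
    linarith [hR.1 x]
  set A := affinity (fun x => P x + δ) (fun x => Q x + δ) with hA
  have hAr : A ≤ r + Fintype.card X * Real.sqrt (δ * (2 + δ)) :=
    (affinity_add_const_le (hS P hP) (hT Q hQ) hδ.le).trans (by linarith [h P hP Q hQ])
  have hA0 : 0 ≤ A := affinity_nonneg _ _
  refine le_trans (eStar_le_of_weights hS hT
    (f := fun x => Real.sqrt ((P x + δ) * (Q x + δ)) / (P x + δ))
    (g := fun x => Real.sqrt ((Q x + δ) * (P x + δ)) / (Q x + δ))
    (fun x => div_nonneg (Real.sqrt_nonneg _) (hpos (hS P hP) x).le)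
    (fun x => div_nonneg (Real.sqrt_nonneg _) (hpos (hT Q hQ) x).le) ?_ hA0 ?_ ?_ n)
    (le_trans (add_le_add (pow_le_pow_left₀ hA0 hAr n) (pow_le_pow_left₀ hA0 hAr n)) hδe.le)
  · intro x
    have h1 := hpos (hS P hP) x
    have h2 := hpos (hT Q hQ) x
    rw [mul_comm (Q x + δ), div_mul_div_comm, Real.mul_self_sqrt (by positivity),
      div_self (by positivity)]
  · intro p hp
    refine le_trans (Finset.sum_le_sum fun x _ => mul_le_mul_of_nonneg_right
      (show p x ≤ p x + δ by linarith) (div_nonneg (Real.sqrt_nonneg _) (hpos (hS P hP) x).le))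
      (sum_weight_le_of_isMax (a := fun x => P x + δ) (a' := fun x => p x + δ)
        (b := fun x => Q x + δ) (hpos (hS P hP)) (hpos (hS p hp))
        (fun x => (hpos (hT Q hQ) x).le) fun t ht ht1 => ?_)
    have := hmax (show (P + t • (p - P), Q) ∈ S ×ˢ T from
      ⟨hSv.add_smul_sub_mem hP hp ⟨ht, ht1⟩, hQ⟩)
    refine le_trans (le_of_eq ?_) this
    simp only [Pi.add_apply, Pi.smul_apply, Pi.sub_apply, smul_eq_mul]
    congr 1
    ext x
    ring
  · intro q hq
    rw [hA, affinity_comm]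
    refine le_trans (Finset.sum_le_sum fun x _ => mul_le_mul_of_nonneg_right
      (show q x ≤ q x + δ by linarith) (div_nonneg (Real.sqrt_nonneg _) (hpos (hT Q hQ) x).le))
      (sum_weight_le_of_isMax (a := fun x => Q x + δ) (a' := fun x => q x + δ)
        (b := fun x => P x + δ) (hpos (hT Q hQ)) (hpos (hT q hq))
        (fun x => (hpos (hS P hP) x).le) fun t ht ht1 => ?_)
    have := hmax (show (P, Q + t • (q - Q)) ∈ S ×ˢ T from
      ⟨hP, hTv.add_smul_sub_mem hQ hq ⟨ht, ht1⟩⟩)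
    rw [affinity_comm, affinity_comm (fun x => Q x + δ)]
    refine le_trans (le_of_eq ?_) this
    simp only [Pi.add_apply, Pi.smul_apply, Pi.sub_apply, smul_eq_mul]
    congr 1
    ext x
    ring

lemma PTV_eq_inter (p : X → ℝ) (ε : ℝ) :
    PTV p ε = stdSimplex ℝ X ∩ {p' | dTV p' p ≤ ε} := rfl

lemma isCompact_PTV (p : X → ℝ) (ε : ℝ) : IsCompact (PTV p ε) := by
  rw [PTV_eq_inter]
  refine (isCompact_stdSimplex ℝ X).inter_right (isClosed_le ?_ continuous_const)
  unfold dTV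
  fun_prop

lemma convex_PTV (p : X → ℝ) (ε : ℝ) : Convex ℝ (PTV p ε) := by
  rw [PTV_eq_inter]
  refine (convex_stdSimplex ℝ X).inter fun u hu v hv s t hs ht hst => ?_
  simp only [Set.mem_ofPred_eq, dTV] at hu hv ⊢
  have : ∑ x, |(s • u + t • v) x - p x| ≤ s * ∑ x, |u x - p x| + t * ∑ x, |v x - p x| := by
    rw [Finset.mul_sum, Finset.mul_sum, ← Finset.sum_add_distrib]
    refine Finset.sum_le_sum fun x _ => ?_
    have e : (s • u + t • v) x - p x = s * (u x - p x) + t * (v x - p x) := by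
      simp only [Pi.add_apply, Pi.smul_apply, smul_eq_mul]
      linear_combination p x * hst
    rw [e]
    refine (abs_add_le _ _).trans (le_of_eq ?_)
    rw [abs_mul, abs_mul, abs_of_nonneg hs, abs_of_nonneg ht]
  have h1 := mul_le_mul_of_nonneg_left hu hs
  have h2 := mul_le_mul_of_nonneg_left hv ht
  have h3 : s * ε + t * ε = ε := by rw [← add_mul, hst, one_mul]
  linarith

lemma self_mem_PTV {p : X → ℝ} (hp : IsDist p) {ε : ℝ} (hε : 0 ≤ ε) : p ∈ PTV p ε :=
  ⟨hp, by simpa [dTV] using hε⟩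

lemma self_mem_PHub {p : X → ℝ} (hp : IsDist p) {ε : ℝ} (hε : 0 ≤ ε) : p ∈ PHub p ε :=
  ⟨hp, fun x => by nlinarith [hp.1 x]⟩

lemma sum_posPart_eq_dTV {p' p : X → ℝ} (hp' : IsDist p') (hp : IsDist p) :
    ∑ x, max (p x - p' x) 0 = dTV p' p := by
  have h : ∀ x, max (p x - p' x) 0 = 1 / 2 * |p' x - p x| + 1 / 2 * (p x - p' x) := fun x => by
    rcases le_total (p x) (p' x) with h | h
    · rw [max_eq_right (by linarith), abs_of_nonneg (by linarith)]; ring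
    · rw [max_eq_left (by linarith), abs_of_nonpos (by linarith)]; ring
  simp only [h, Finset.sum_add_distrib, ← Finset.mul_sum, Finset.sum_sub_distrib, hp.2, hp'.2, dTV]
  ring

lemma PHub_subset_PTV {p : X → ℝ} (hp : IsDist p) {ε : ℝ} (hε : 0 ≤ ε) :
    PHub p ε ⊆ PTV p ε := by
  rintro p' ⟨hp', h⟩
  refine ⟨hp', ?_⟩
  rw [← sum_posPart_eq_dTV hp' hp]
  calc ∑ x, max (p x - p' x) 0 ≤ ∑ x, ε * p x :=
        Finset.sum_le_sum fun x _ =>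
          max_le (by linarith [h x]) (mul_nonneg hε (hp.1 x))
    _ = ε := by rw [← Finset.mul_sum, hp.2, mul_one]

lemma affinity_add_le {P Q c : X → ℝ} (hP : ∀ x, 0 ≤ P x) (hQ : ∀ x, 0 ≤ Q x)
    (hc : ∀ x, 0 ≤ c x) :
    affinity P Q + ∑ x, c x ≤ affinity (fun x => P x + c x) (fun x => Q x + c x) := by
  unfold affinity
  rw [← Finset.sum_add_distrib]
  refine Finset.sum_le_sum fun x _ => Real.le_sqrt_of_sq_le ?_
  have hPQ := Real.sq_sqrt (mul_nonneg (hP x) (hQ x))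
  have hs : Real.sqrt (P x * Q x) ≤ (P x + Q x) / 2 := by
    rw [Real.sqrt_le_left (by linarith [hP x, hQ x])]
    nlinarith [sq_nonneg (P x - Q x)]
  nlinarith [mul_le_mul_of_nonneg_left hs (hc x)]

/-- Mixing two TV-perturbations with a common contamination produces Huber-perturbations that are
no easier to distinguish. -/
lemma exists_PHub_affinity_ge {p q P Q : X → ℝ} (hp : IsDist p) (hq : IsDist q) {ε : ℝ}
    (hP : P ∈ PTV p (ε / 2)) (hQ : Q ∈ PTV q (ε / 2)) :
    ∃ P' ∈ PHub p ε, ∃ Q' ∈ PHub q ε, affinity P Q ≤ affinity P' Q' := by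
  let c : X → ℝ := fun x => max (p x - P x) 0 + max (q x - Q x) 0
  have hc : ∀ x, 0 ≤ c x := fun x => add_nonneg (le_max_right _ _) (le_max_right _ _)
  have hγ : ∑ x, c x ≤ ε := by
    simp only [c, Finset.sum_add_distrib]
    rw [sum_posPart_eq_dTV hP.1 hp, sum_posPart_eq_dTV hQ.1 hq]
    linarith [hP.2, hQ.2]
  have hγ0 : 0 ≤ ∑ x, c x := Finset.sum_nonneg fun x _ => hc x
  have hA := affinity_add_le hP.1.1 hQ.1.1 hc
  have hA1 := affinity_le_one hP.1 hQ.1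
  set γ := ∑ x, c x with hγdef
  have hM : 0 < 1 + γ := by linarith
  have mem : ∀ {u U : X → ℝ}, IsDist u → IsDist U → (∀ x, u x ≤ U x + c x) →
      (fun x => (U x + c x) / (1 + γ)) ∈ PHub u ε := by
    intro u U hu hU huU
    refine ⟨⟨fun x => div_nonneg (add_nonneg (hU.1 x) (hc x)) hM.le, ?_⟩, fun x => ?_⟩
    · rw [← Finset.sum_div, Finset.sum_add_distrib, hU.2, ← hγdef, div_self hM.ne']
    · rw [le_div_iff₀ hM]
      have h1 : (1 - ε) * (1 + γ) ≤ 1 := by nlinarith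
      nlinarith [mul_le_mul_of_nonneg_right h1 (hu.1 x), huU x]
  refine ⟨_, mem hp hP.1 fun x => ?_, _, mem hq hQ.1 fun x => ?_, ?_⟩
  · simp only [c]
    linarith [le_max_left (p x - P x) 0, le_max_right (q x - Q x) 0]
  · simp only [c]
    linarith [le_max_left (q x - Q x) 0, le_max_right (p x - P x) 0]
  · have e : affinity (fun x => (P x + c x) / (1 + γ)) (fun x => (Q x + c x) / (1 + γ)) =
        affinity (fun x => P x + c x) (fun x => Q x + c x) / (1 + γ) := by
      simp only [affinity, Finset.sum_div]
      refine Finset.sum_congr rfl fun x _ => ?_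
      rw [div_mul_div_comm, Real.sqrt_div' _ (mul_self_nonneg _), Real.sqrt_mul_self hM.le]
    rw [e, le_div_iff₀ hM]
    nlinarith [mul_le_mul_of_nonneg_right hA1 hγ0]

lemma eStar_PTV_le_of_eStar_PHub_le {p q : X → ℝ} (hp : IsDist p) (hq : IsDist q) {ε : ℝ}
    (hε : 0 ≤ ε) {n : ℕ} (hn : eStar (PHub p ε) (PHub q ε) n ≤ 1 / 10) :
    eStar (PTV p (ε / 2)) (PTV q (ε / 2)) (4 * n) ≤ 1 / 10 := by
  have hHub : ∀ {P Q : X → ℝ}, P ∈ PHub p ε → Q ∈ PHub q ε → affinity P Q ^ (2 * n) ≤ 1 / 5 := by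
    intro P Q hP hQ
    linarith [affinity_pow_le_eStar (S := PHub p ε) (T := PHub q ε) (fun _ h => h.1)
      (fun _ h => h.1) hP hQ n]
  have hn0 : 2 * n ≠ 0 := by
    intro h0
    have := hHub (self_mem_PHub hp hε) (self_mem_PHub hq hε)
    rw [h0, pow_zero] at this
    norm_num at this
  set r : ℝ := (1 / 5) ^ (((2 * n : ℕ) : ℝ)⁻¹)
  have hr : r ^ (2 * n) = 1 / 5 := Real.rpow_inv_natCast_pow (by norm_num) hn0
  have hr0 : 0 ≤ r := Real.rpow_nonneg (by norm_num) _
  refine eStar_le_of_affinity_le (r := r) (fun _ h => h.1) (fun _ h => h.1) (isCompact_PTV _ _)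
    (isCompact_PTV _ _) (convex_PTV _ _) (convex_PTV _ _) ⟨p, self_mem_PTV hp (by linarith)⟩
    ⟨q, self_mem_PTV hq (by linarith)⟩ ?_ _ ?_
  · intro P hP Q hQ
    obtain ⟨P', hP', Q', hQ', hle⟩ := exists_PHub_affinity_ge hp hq hP hQ
    exact hle.trans ((pow_le_pow_iff_left₀ (affinity_nonneg _ _) hr0 hn0).1
      ((hHub hP' hQ').trans hr.ge))
  · rw [show 4 * n = 2 * n * 2 by ring, pow_mul, hr]
    norm_num

end

/-- Sandwich bounds between the Huber and TV sample complexities: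
`n*_TV(ε/2) ≲ n*_Hub(ε) ≲ n*_TV(ε)`. -/
theorem tv_hub_sandwich :
    ∃ C : ℝ, 0 < C ∧
      ∀ (X : Type) [Fintype X] [Nonempty X] (p q : X → ℝ),
        IsDist p → IsDist q →
        ∀ ε : ℝ, 0 < ε → ε ≤ dTV p q / 4 →
          nStar (PTV p (ε / 2)) (PTV q (ε / 2)) ≤
            ENNReal.ofReal C * nStar (PHub p ε) (PHub q ε) ∧
          nStar (PHub p ε) (PHub q ε) ≤
            ENNReal.ofReal C * nStar (PTV p ε) (PTV q ε) := by
  refine ⟨4, by norm_num, fun X _ _ p q hp hq ε hε _ => ?_⟩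
  have h4 : ENNReal.ofReal 4 = ((4 : ℕ) : ℝ≥0∞) := by simp
  rw [h4]
  refine ⟨nStar_le_mul (by norm_num) fun n hn => eStar_PTV_le_of_eStar_PHub_le hp hq hε.le hn, ?_⟩
  have h1 := nStar_le_mul (k := 1) (S := PTV p ε) (T := PTV q ε) (S' := PHub p ε)
    (T' := PHub q ε) one_ne_zero fun n hn => by
      rw [one_mul]
      exact (eStar_mono ⟨p, self_mem_PHub hp hε.le⟩ ⟨q, self_mem_PHub hq hε.le⟩
        (PHub_subset_PTV hp hε.le) (PHub_subset_PTV hq hε.le) (fun _ h => h.1)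
        (fun _ h => h.1) n).trans hn
  exact h1.trans (mul_le_mul_left (by norm_num) _)

end
end

section
/- Let p, q be distributions on a nonempty finite set X, let 0 < c_L < 1 < c_U, and let ε ∈ [0, 1/2]. Partition X into L = {x : p(x) < c_L·q(x)}, H = {x : p(x) > c_U·q(x)}, and M = X ∖ (L ∪ H). Define the nonnegative functions (not necessarily summing to 1): p*_TV(x) = c_L(p(x)+q(x))/(1+c_L) on L, p(x) on M, c_U(p(x)+q(x))/(1+c_U) on H; q*_TV(x) = (p(x)+q(x))/(1+c_L) on L, q(x) on M, (p(x)+q(x))/(1+c_U) on H; p*_Hub(x) = (1−ε)c_L·q(x) on L and (1−ε)p(x) on M ∪ H; q*_Hub(x) = (1−ε)q(x) on L ∪ M and (1−ε)p(x)/c_U on H. Then (1/2)·H²(p*_TV, q*_TV) ≤ H²(p*_Hub, q*_Hub) ≤ 2·H²(p*_TV, q*_TV), where H²(u,v) = ∑_{x∈X}(√(u(x)) − √(v(x)))² for nonnegative functions u, v on X. -/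
open scoped Classical
open Finset

noncomputable section

/-- The squared root difference of two multiples of a common nonnegative scale. -/
theorem sq_sqrt_mul_sub_sqrt_mul {t : ℝ} (ht : 0 ≤ t) (a b : ℝ) :
    (Real.sqrt (t * a) - Real.sqrt (t * b)) ^ 2 = t * (Real.sqrt a - Real.sqrt b) ^ 2 := by
  rw [Real.sqrt_mul ht, Real.sqrt_mul ht, ← mul_sub, mul_pow, Real.sq_sqrt ht]

/-- Squared root differences of two pairs with the same ratio are comparable when their scales
are. -/
theorem sq_sqrt_sub_sqrt_comparable {c s t u v : ℝ} (hs : 0 ≤ s) (ht : 0 ≤ t)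
    (hts : t ≤ 2 * s) (hst : s ≤ 2 * t) (hu : u = t * c) (hv : v = s * c) :
    (1 / 2) * (Real.sqrt u - Real.sqrt t) ^ 2 ≤ (Real.sqrt v - Real.sqrt s) ^ 2 ∧
      (Real.sqrt v - Real.sqrt s) ^ 2 ≤ 2 * (Real.sqrt u - Real.sqrt t) ^ 2 := by
  have h₁ := sq_sqrt_mul_sub_sqrt_mul ht c 1
  have h₂ := sq_sqrt_mul_sub_sqrt_mul hs c 1
  rw [mul_one] at h₁ h₂
  rw [hu, hv, h₁, h₂]
  have := sq_nonneg (Real.sqrt c - Real.sqrt 1)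
  constructor <;> nlinarith

/-- Hellinger comparability of the TV- and Huber-LFD formulas at the same clips. -/
theorem hellinger_comparability
    {X : Type*} [Fintype X] [Nonempty X]
    (p q : X → ℝ) (hp : IsDist p) (hq : IsDist q)
    (cL cU ε : ℝ) (hcL0 : 0 < cL) (hcL1 : cL < 1) (hcU : 1 < cU)
    (hε0 : 0 ≤ ε) (hε : ε ≤ 1 / 2)
    (pTVs qTVs pHubs qHubs : X → ℝ)
    (hpTV : ∀ x, pTVs x =
      if p x < cL * q x then cL * (p x + q x) / (1 + cL)
      else if p x > cU * q x then cU * (p x + q x) / (1 + cU)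
      else p x)
    (hqTV : ∀ x, qTVs x =
      if p x < cL * q x then (p x + q x) / (1 + cL)
      else if p x > cU * q x then (p x + q x) / (1 + cU)
      else q x)
    (hpHub : ∀ x, pHubs x =
      if p x < cL * q x then (1 - ε) * (cL * q x) else (1 - ε) * p x)
    (hqHub : ∀ x, qHubs x =
      if p x > cU * q x then (1 - ε) * p x / cU else (1 - ε) * q x) :
    (1 / 2) * hellSq pTVs qTVs ≤ hellSq pHubs qHubs ∧
      hellSq pHubs qHubs ≤ 2 * hellSq pTVs qTVs := by
  have key : ∀ x,
      (1 / 2) * (Real.sqrt (pTVs x) - Real.sqrt (qTVs x)) ^ 2 ≤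
          (Real.sqrt (pHubs x) - Real.sqrt (qHubs x)) ^ 2 ∧
        (Real.sqrt (pHubs x) - Real.sqrt (qHubs x)) ^ 2 ≤
          2 * (Real.sqrt (pTVs x) - Real.sqrt (qTVs x)) ^ 2 := by
    intro x
    have hpx := hp.1 x
    have hqx := hq.1 x
    rw [hpTV, hqTV, hpHub, hqHub]
    generalize p x = a at *
    generalize q x = b at *
    have hε1 : 0 ≤ 1 - ε := by linarith
    by_cases hL : a < cL * b
    · have hH : ¬ a > cU * b := by
        intro h
        nlinarith
      simp only [hL, hH, if_true, if_false]
      have hcL : 0 < 1 + cL := by linarith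
      have upper : (a + b) / (1 + cL) ≤ b := by
        rw [div_le_iff₀ hcL]
        linarith
      have lower : b ≤ 2 * ((a + b) / (1 + cL)) := by
        rw [← mul_div_assoc, le_div_iff₀ hcL]
        nlinarith
      exact sq_sqrt_sub_sqrt_comparable (c := cL) (by positivity) (by positivity)
        (by nlinarith) (by nlinarith) (by ring) (by ring)
    · by_cases hH : a > cU * b
      · simp only [hL, hH, if_true, if_false]
        have hcU0 : 0 < cU := by linarith
        have hcU1 : 0 < 1 + cU := by linarith
        have upper : (a + b) / (1 + cU) ≤ a / cU := by
          rw [div_le_div_iff₀ hcU1 hcU0]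
          nlinarith
        have lower : a / cU ≤ 2 * ((a + b) / (1 + cU)) := by
          rw [← mul_div_assoc, div_le_div_iff₀ hcU0 hcU1]
          nlinarith [mul_nonneg hpx (sub_nonneg.2 hcU.le), mul_nonneg hqx hcU0.le]
        have hs : 0 ≤ a / cU := by positivity
        rw [mul_div_assoc (1 - ε)]
        exact sq_sqrt_sub_sqrt_comparable (c := cU) (by positivity) (by positivity)
          (by nlinarith) (by nlinarith) (by ring) (by field_simp)
      · simp only [hL, hH, if_false]
        rw [sq_sqrt_mul_sub_sqrt_mul hε1]
        have := sq_nonneg (Real.sqrt a - Real.sqrt b)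
        constructor <;> nlinarith
  unfold hellSq
  rw [mul_sum, mul_sum]
  exact ⟨sum_le_sum fun x _ => (key x).1, sum_le_sum fun x _ => (key x).2⟩

end
end

section
/- Let p, q be distributions on a nonempty finite set X and let ε ∈ (0, 1/2]. Suppose c_U^Hub > 1 satisfies ∑_{x∈X} max(p(x) − c_U^Hub·q(x), 0) = c_U^Hub·ε/(1−ε), and c_U^TV > 1 satisfies ∑_{x∈X} max(p(x) − c_U^TV·q(x), 0) = (1 + c_U^TV)·ε/2. Then c_U^Hub ≤ c_U^TV. Similarly, suppose c_L^Hub ∈ (0,1) satisfies ∑_{x∈X} max(c_L^Hub·q(x) − p(x), 0) = ε/(1−ε), and c_L^TV ∈ (0,1) satisfies ∑_{x∈X} max(c_L^TV·q(x) − p(x), 0) = (1 + c_L^TV)·ε/2. Then c_L^TV ≤ c_L^Hub. (That is, the Huber clips at level ε lie between the TV clips at level ε/2.) -/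
open scoped Classical
open Finset

noncomputable section

/-- A finite sum of positive parts is monotone in its summands. -/
theorem sum_max_zero_mono {X : Type*} [Fintype X] {f g : X → ℝ} (h : ∀ x, f x ≤ g x) :
    ∑ x, max (f x) 0 ≤ ∑ x, max (g x) 0 :=
  Finset.sum_le_sum fun x _ => max_le_max_right 0 (h x)

/-- Ordering of the clips: the Huber clips at level ε lie between the TV clips at
level ε/2. -/
theorem clip_ordering
    {X : Type*} [Fintype X] [Nonempty X]
    (p q : X → ℝ) (hp : IsDist p) (hq : IsDist q)
    (ε : ℝ) (hε0 : 0 < ε) (hε : ε ≤ 1 / 2)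
    (cUHub cUTV cLHub cLTV : ℝ)
    (hcUHub : 1 < cUHub) (hcUTV : 1 < cUTV)
    (hcLHub0 : 0 < cLHub) (hcLHub1 : cLHub < 1)
    (hcLTV0 : 0 < cLTV) (hcLTV1 : cLTV < 1)
    (heqUHub : ∑ x, max (p x - cUHub * q x) 0 = cUHub * ε / (1 - ε))
    (heqUTV : ∑ x, max (p x - cUTV * q x) 0 = (1 + cUTV) * ε / 2)
    (heqLHub : ∑ x, max (cLHub * q x - p x) 0 = ε / (1 - ε))
    (heqLTV : ∑ x, max (cLTV * q x - p x) 0 = (1 + cLTV) * ε / 2) :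
    cUHub ≤ cUTV ∧ cLTV ≤ cLHub := by
  have hε1 : 0 < 1 - ε := by linarith
  have hle : ε ≤ ε / (1 - ε) := by
    rw [le_div_iff₀ hε1]
    nlinarith
  constructor
  · by_contra! hlt
    have hmono := sum_max_zero_mono (f := fun x => p x - cUHub * q x)
      (g := fun x => p x - cUTV * q x)
      fun x => sub_le_sub_left (mul_le_mul_of_nonneg_right hlt.le (hq.1 x)) _
    rw [heqUHub, heqUTV, mul_div_assoc] at hmono
    nlinarith
  · by_contra! hlt
    have hmono := sum_max_zero_mono (f := fun x => cLHub * q x - p x)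
      (g := fun x => cLTV * q x - p x)
      fun x => sub_le_sub_right (mul_le_mul_of_nonneg_right hlt.le (hq.1 x)) _
    rw [heqLHub, heqLTV] at hmono
    nlinarith

end
end

section
/- There exist universal constants c > 0 and C > 0 such that the following holds for all distributions p, q on any nonempty finite set X. Define A₁ = {x : q(x) ≤ p(x) < 2q(x)}, A₂ = {x : p(x) ≥ 2q(x)}, B₁ = {x : p(x) < q(x) ≤ 2p(x)}, B₂ = {x : q(x) > 2p(x)}, A = A₁ ∪ A₂, and B = B₁ ∪ B₂. Then c·(p(A₂) + ∑_{x∈A₁} (p(x) − q(x))²/p(x)) ≤ ∑_{x∈A} (√(p(x)) − √(q(x)))² ≤ C·(p(A₂) + ∑_{x∈A₁} (p(x) − q(x))²/p(x)), and c·(q(B₂) + ∑_{x∈B₁} (p(x) − q(x))²/q(x)) ≤ ∑_{x∈B} (√(p(x)) − √(q(x)))² ≤ C·(q(B₂) + ∑_{x∈B₁} (p(x) − q(x))²/q(x)). Consequently H²(p,q) lies within universal constant factors of p(A₂) + q(B₂) + ∑_{x∈A₁}(p(x)−q(x))²/p(x) + ∑_{x∈B₁}(p(x)−q(x))²/q(x).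 -/
open scoped Classical
open Finset

noncomputable section

/-- If `b ≤ a`, then `(√a - √b)²` is within constant factors of `(a - b)² / a`. -/
theorem sqrt_sub_sqrt_sq_bounds_of_le {a b : ℝ} (hb : 0 ≤ b) (hab : b ≤ a) :
    1 / 16 * ((a - b) ^ 2 / a) ≤ (Real.sqrt a - Real.sqrt b) ^ 2 ∧
      (Real.sqrt a - Real.sqrt b) ^ 2 ≤ (a - b) ^ 2 / a := by
  rcases (hb.trans hab).eq_or_lt with rfl | ha
  · obtain rfl := le_antisymm hab hb
    simp
  have hs := Real.sq_sqrt ha.le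
  have ht := Real.sq_sqrt hb
  have hst := Real.sqrt_le_sqrt hab
  have ht0 := Real.sqrt_nonneg b
  set s := Real.sqrt a
  set t := Real.sqrt b
  have hfac : (a - b) ^ 2 = (s - t) ^ 2 * (s + t) ^ 2 := by rw [← hs, ← ht]; ring
  rw [← mul_div_assoc, div_le_iff₀ ha, le_div_iff₀ ha, hfac]
  have h₁ : a ≤ (s + t) ^ 2 := by nlinarith
  have h₂ : (s + t) ^ 2 ≤ 16 * a := by nlinarith
  exact ⟨by nlinarith [mul_le_mul_of_nonneg_left h₂ (sq_nonneg (s - t))],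
    mul_le_mul_of_nonneg_left h₁ (sq_nonneg (s - t))⟩

/-- If `2 * b ≤ a`, then `(√a - √b)²` is within constant factors of `a`. -/
theorem sqrt_sub_sqrt_sq_bounds_of_two_mul_le {a b : ℝ} (hb : 0 ≤ b) (hab : 2 * b ≤ a) :
    1 / 16 * a ≤ (Real.sqrt a - Real.sqrt b) ^ 2 ∧ (Real.sqrt a - Real.sqrt b) ^ 2 ≤ a := by
  have hs := Real.sq_sqrt (show 0 ≤ a by linarith)
  have ht := Real.sq_sqrt hb
  have hs0 := Real.sqrt_nonneg a
  have ht0 := Real.sqrt_nonneg b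
  set s := Real.sqrt a
  set t := Real.sqrt b
  have hst : t ≤ 3 / 4 * s := abs_le_of_sq_le_sq' (by nlinarith) (by positivity) |>.2
  constructor <;> nlinarith

/-- The Hellinger sum over a set where the ratio `p / q` is moderate together with a set where it
is at least two, up to constant factors. -/
theorem sum_sqrt_sub_sqrt_sq_bounds {X : Type*} {p q : X → ℝ} (hq : ∀ x, 0 ≤ q x)
    {M E : Finset X} (hME : Disjoint M E) (hM : ∀ x ∈ M, q x ≤ p x)
    (hE : ∀ x ∈ E, 2 * q x ≤ p x) :
    1 / 16 * ((∑ x ∈ E, p x) + ∑ x ∈ M, (p x - q x) ^ 2 / p x) ≤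
        ∑ x ∈ M ∪ E, (Real.sqrt (p x) - Real.sqrt (q x)) ^ 2 ∧
      ∑ x ∈ M ∪ E, (Real.sqrt (p x) - Real.sqrt (q x)) ^ 2 ≤
        1 * ((∑ x ∈ E, p x) + ∑ x ∈ M, (p x - q x) ^ 2 / p x) := by
  rw [sum_union hME, one_mul, mul_add, mul_sum, mul_sum, add_comm (∑ x ∈ E, 1 / 16 * p x),
    add_comm (∑ x ∈ E, p x)]
  exact ⟨add_le_add
      (sum_le_sum fun x hx => (sqrt_sub_sqrt_sq_bounds_of_le (hq x) (hM x hx)).1)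
      (sum_le_sum fun x hx => (sqrt_sub_sqrt_sq_bounds_of_two_mul_le (hq x) (hE x hx)).1),
    add_le_add
      (sum_le_sum fun x hx => (sqrt_sub_sqrt_sq_bounds_of_le (hq x) (hM x hx)).2)
      (sum_le_sum fun x hx => (sqrt_sub_sqrt_sq_bounds_of_two_mul_le (hq x) (hE x hx)).2)⟩

/-- A formula for the squared Hellinger divergence up to universal constant factors, split
according to the likelihood ratio being moderate or extreme. -/
theorem approx_hellinger_formula :
    ∃ c C : ℝ, 0 < c ∧ 0 < C ∧
      ∀ (X : Type) [Fintype X] [Nonempty X] (p q : X → ℝ),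
        IsDist p → IsDist q →
        (c * ((∑ x ∈ univ.filter (fun x => 2 * q x ≤ p x), p x) +
              ∑ x ∈ univ.filter (fun x => q x ≤ p x ∧ p x < 2 * q x),
                (p x - q x) ^ 2 / p x) ≤
            ∑ x ∈ univ.filter (fun x => q x ≤ p x ∧ p x < 2 * q x) ∪
                univ.filter (fun x => 2 * q x ≤ p x),
              (Real.sqrt (p x) - Real.sqrt (q x)) ^ 2 ∧
          ∑ x ∈ univ.filter (fun x => q x ≤ p x ∧ p x < 2 * q x) ∪
              univ.filter (fun x => 2 * q x ≤ p x),
            (Real.sqrt (p x) - Real.sqrt (q x)) ^ 2 ≤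
            C * ((∑ x ∈ univ.filter (fun x => 2 * q x ≤ p x), p x) +
              ∑ x ∈ univ.filter (fun x => q x ≤ p x ∧ p x < 2 * q x),
                (p x - q x) ^ 2 / p x)) ∧
        (c * ((∑ x ∈ univ.filter (fun x => 2 * p x < q x), q x) +
              ∑ x ∈ univ.filter (fun x => p x < q x ∧ q x ≤ 2 * p x),
                (p x - q x) ^ 2 / q x) ≤
            ∑ x ∈ univ.filter (fun x => p x < q x ∧ q x ≤ 2 * p x) ∪
                univ.filter (fun x => 2 * p x < q x),
              (Real.sqrt (p x) - Real.sqrt (q x)) ^ 2 ∧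
          ∑ x ∈ univ.filter (fun x => p x < q x ∧ q x ≤ 2 * p x) ∪
              univ.filter (fun x => 2 * p x < q x),
            (Real.sqrt (p x) - Real.sqrt (q x)) ^ 2 ≤
            C * ((∑ x ∈ univ.filter (fun x => 2 * p x < q x), q x) +
              ∑ x ∈ univ.filter (fun x => p x < q x ∧ q x ≤ 2 * p x),
                (p x - q x) ^ 2 / q x)) ∧
        (c * ((∑ x ∈ univ.filter (fun x => 2 * q x ≤ p x), p x) +
              (∑ x ∈ univ.filter (fun x => 2 * p x < q x), q x) +
              (∑ x ∈ univ.filter (fun x => q x ≤ p x ∧ p x < 2 * q x),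
                (p x - q x) ^ 2 / p x) +
              ∑ x ∈ univ.filter (fun x => p x < q x ∧ q x ≤ 2 * p x),
                (p x - q x) ^ 2 / q x) ≤ hellSq p q ∧
          hellSq p q ≤
            C * ((∑ x ∈ univ.filter (fun x => 2 * q x ≤ p x), p x) +
              (∑ x ∈ univ.filter (fun x => 2 * p x < q x), q x) +
              (∑ x ∈ univ.filter (fun x => q x ≤ p x ∧ p x < 2 * q x),
                (p x - q x) ^ 2 / p x) +
              ∑ x ∈ univ.filter (fun x => p x < q x ∧ q x ≤ 2 * p x),
                (p x - q x) ^ 2 / q x)) := by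
  refine ⟨1 / 16, 1, by norm_num, one_pos, ?_⟩
  intro X _ _ p q hp hq
  have hA := sum_sqrt_sub_sqrt_sq_bounds (p := p) (q := q) hq.1
    (M := univ.filter (fun x => q x ≤ p x ∧ p x < 2 * q x))
    (E := univ.filter (fun x => 2 * q x ≤ p x))
    (by rw [disjoint_filter]; intro x _ h; linarith [h.2])
    (by simp +contextual) (by simp)
  have hB := sum_sqrt_sub_sqrt_sq_bounds (p := q) (q := p) hp.1
    (M := univ.filter (fun x => p x < q x ∧ q x ≤ 2 * p x))
    (E := univ.filter (fun x => 2 * p x < q x))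
    (by rw [disjoint_filter]; intro x _ h; linarith [h.2])
    (by simp +contextual [le_of_lt]) (by simp +contextual [le_of_lt])
  simp only [sub_sq_comm (q _) (p _), sub_sq_comm (Real.sqrt (q _)) (Real.sqrt (p _))] at hB
  have hsum : hellSq p q =
      ∑ x ∈ univ.filter (fun x => q x ≤ p x ∧ p x < 2 * q x) ∪
          univ.filter (fun x => 2 * q x ≤ p x), (Real.sqrt (p x) - Real.sqrt (q x)) ^ 2 +
        ∑ x ∈ univ.filter (fun x => p x < q x ∧ q x ≤ 2 * p x) ∪
          univ.filter (fun x => 2 * p x < q x), (Real.sqrt (p x) - Real.sqrt (q x)) ^ 2 := by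
    rw [hellSq, ← sum_filter_add_sum_filter_not univ (fun x => q x ≤ p x)]
    congr 1 <;> refine sum_congr ?_ fun _ _ => rfl <;> ext x <;>
      have hpx := hp.1 x <;> have hqx := hq.1 x <;>
      simp only [mem_filter, mem_union, mem_univ, true_and] <;> grind
  refine ⟨hA, hB, ?_⟩
  rw [hsum]
  constructor <;> linarith [hA.1, hA.2, hB.1, hB.2]

end
end

section
/- Let p, q be distributions on a nonempty finite set X and let 0 ≤ ε₁ ≤ ε₂ ≤ 1. For j = 1, 2 suppose there exist clips c_L(j) ∈ (0,1) and c_U(j) ∈ (1,∞) satisfying the subtractive fixed-point equations ∑_{x∈X} max(p(x) − c_U(j)·q(x), 0) = ε_j/(1+ε_j) and ∑_{x∈X} max(q(x) − p(x)/c_L(j), 0) = ε_j/(1+ε_j), and let (p*_j, q*_j) be the corresponding ε_j-subtractive least favourable distributions given by the explicit formulas: p*_j(x) = c_U(j)(1+ε_j)q(x) when p(x) > c_U(j)·q(x) and p*_j(x) = (1+ε_j)p(x) otherwise; q*_j(x) = ((1+ε_j)/c_L(j))·p(x) when p(x) < c_L(j)·q(x) and q*_j(x) = (1+ε_j)q(x)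 otherwise. Let A = {x : p(x) ≥ q(x)} and B = {x : p(x) < q(x)}. Then ∑_{x∈A}(√(p*_2(x)) − √(q*_2(x)))² ≤ 2·∑_{x∈A}(√(p*_1(x)) − √(q*_1(x)))² and ∑_{x∈B}(√(p*_2(x)) − √(q*_2(x)))² ≤ 2·∑_{x∈B}(√(p*_1(x)) − √(q*_1(x)))². That is, the contributions to the Hellinger divergence between the subtractive least favourable distributions from A and from B are each approximately monotone nonincreasing in ε. -/
open scoped Classical
open Finset

noncomputable section

/-- Larger total excess of `a` over `c * b` forces a pointwise smaller truncation `min a (c * b)`. -/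
theorem min_le_min_of_sum_excess_le {X : Type*} [Fintype X] {a b : X → ℝ} {c d : ℝ}
    (hb : ∀ x, 0 ≤ b x)
    (h : ∑ x, max (a x - c * b x) 0 ≤ ∑ x, max (a x - d * b x) 0) (x : X) :
    min (a x) (d * b x) ≤ min (a x) (c * b x) := by
  have hmin : ∀ u v : ℝ, min u v = u - max (u - v) 0 := by
    intro u v
    rcases le_total u v with huv | huv
    · rw [min_eq_left huv, max_eq_right (by linarith)]; ring
    · rw [min_eq_right huv, max_eq_left (by linarith)]; ring
  rcases le_total d c with hdc | hcd
  · exact min_le_min_left _ (mul_le_mul_of_nonneg_right hdc (hb x))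
  · have hle : ∀ y ∈ univ, max (a y - d * b y) 0 ≤ max (a y - c * b y) 0 := fun y _ =>
      max_le_max_right _ (sub_le_sub_left (mul_le_mul_of_nonneg_right hcd (hb y)) _)
    have heq := (Finset.sum_eq_sum_iff_of_le hle).1 (le_antisymm (Finset.sum_le_sum hle) h)
    rw [hmin, hmin, heq x (mem_univ x)]

theorem sq_sqrt_sub_sqrt_scaled_le {b m n s t : ℝ} (hbm : b ≤ m) (hmn : m ≤ n)
    (hs : 1 ≤ s) (ht0 : 0 ≤ t) (ht : t ≤ 2) :
    (√(t * m) - √(t * b)) ^ 2 ≤ 2 * (√(s * n) - √(s * b)) ^ 2 := by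
  have hs0 : 0 ≤ s := by linarith
  have h₁ : √b ≤ √m := Real.sqrt_le_sqrt hbm
  have h₂ : √m ≤ √n := Real.sqrt_le_sqrt hmn
  rw [Real.sqrt_mul ht0, Real.sqrt_mul ht0, Real.sqrt_mul hs0, Real.sqrt_mul hs0,
    ← mul_sub, ← mul_sub, mul_pow, mul_pow, Real.sq_sqrt ht0, Real.sq_sqrt hs0]
  have hsq : (√m - √b) ^ 2 ≤ (√n - √b) ^ 2 := by gcongr
  calc t * (√m - √b) ^ 2 ≤ 2 * (√n - √b) ^ 2 := by gcongr
    _ ≤ 2 * (s * (√n - √b) ^ 2) := by nlinarith [sq_nonneg (√n - √b)]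

theorem ite_truncation_eq (a b c s : ℝ) :
    (if a > c * b then c * s * b else s * a) = s * min a (c * b) := by
  split_ifs with h
  · rw [min_eq_right h.le]; ring
  · rw [min_eq_left (not_lt.1 h)]

theorem ite_lower_truncation_eq {a b c s : ℝ} (hc : 0 < c) :
    (if a < c * b then s / c * a else s * b) = s * min b (c⁻¹ * a) := by
  rw [← ite_truncation_eq]
  have hiff : a < c * b ↔ b > c⁻¹ * a := by rw [gt_iff_lt, inv_mul_lt_iff₀ hc]
  simp only [hiff, div_eq_inv_mul, mul_right_comm]

/-- Approximate monotonicity in ε of the contributions to the Hellinger divergence between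
the subtractive least favourable distributions from `A = {p ≥ q}` and `B = {p < q}`. -/
theorem subtractive_hellinger_contributions_monotone
    {X : Type*} [Fintype X] [Nonempty X]
    (p q : X → ℝ) (hp : IsDist p) (hq : IsDist q)
    (ε₁ ε₂ : ℝ) (h0 : 0 ≤ ε₁) (h12 : ε₁ ≤ ε₂) (h2 : ε₂ ≤ 1)
    (cL₁ cU₁ cL₂ cU₂ : ℝ)
    (hcL₁0 : 0 < cL₁) (hcL₁1 : cL₁ < 1) (hcU₁ : 1 < cU₁)
    (hcL₂0 : 0 < cL₂) (hcL₂1 : cL₂ < 1) (hcU₂ : 1 < cU₂)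
    (hfixU₁ : ∑ x, max (p x - cU₁ * q x) 0 = ε₁ / (1 + ε₁))
    (hfixL₁ : ∑ x, max (q x - p x / cL₁) 0 = ε₁ / (1 + ε₁))
    (hfixU₂ : ∑ x, max (p x - cU₂ * q x) 0 = ε₂ / (1 + ε₂))
    (hfixL₂ : ∑ x, max (q x - p x / cL₂) 0 = ε₂ / (1 + ε₂))
    (p₁ q₁ p₂ q₂ : X → ℝ)
    (hp₁ : ∀ x, p₁ x =
      if p x > cU₁ * q x then cU₁ * (1 + ε₁) * q x else (1 + ε₁) * p x)
    (hq₁ : ∀ x, q₁ x =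
      if p x < cL₁ * q x then ((1 + ε₁) / cL₁) * p x else (1 + ε₁) * q x)
    (hp₂ : ∀ x, p₂ x =
      if p x > cU₂ * q x then cU₂ * (1 + ε₂) * q x else (1 + ε₂) * p x)
    (hq₂ : ∀ x, q₂ x =
      if p x < cL₂ * q x then ((1 + ε₂) / cL₂) * p x else (1 + ε₂) * q x) :
    (∑ x ∈ univ.filter (fun x => q x ≤ p x),
        (Real.sqrt (p₂ x) - Real.sqrt (q₂ x)) ^ 2 ≤
      2 * ∑ x ∈ univ.filter (fun x => q x ≤ p x),
        (Real.sqrt (p₁ x) - Real.sqrt (q₁ x)) ^ 2) ∧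
    (∑ x ∈ univ.filter (fun x => p x < q x),
        (Real.sqrt (p₂ x) - Real.sqrt (q₂ x)) ^ 2 ≤
      2 * ∑ x ∈ univ.filter (fun x => p x < q x),
        (Real.sqrt (p₁ x) - Real.sqrt (q₁ x)) ^ 2) := by
  have hp0 := hp.1
  have hq0 := hq.1
  have hs : (1 : ℝ) ≤ 1 + ε₁ := by linarith
  have ht0 : (0 : ℝ) ≤ 1 + ε₂ := by linarith
  have ht : 1 + ε₂ ≤ 2 := by linarith
  have hε : ε₁ / (1 + ε₁) ≤ ε₂ / (1 + ε₂) := by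
    rw [div_le_div_iff₀ (by linarith) (by linarith)]
    nlinarith
  have hU := min_le_min_of_sum_excess_le hq0 (hfixU₁.trans_le (hε.trans_eq hfixU₂.symm))
  simp only [div_eq_inv_mul (p _)] at hfixL₁ hfixL₂
  have hL := min_le_min_of_sum_excess_le hp0 (hfixL₁.trans_le (hε.trans_eq hfixL₂.symm))
  have hI₁ : 1 ≤ cL₁⁻¹ := (one_le_inv₀ hcL₁0).2 hcL₁1.le
  have hI₂ : 1 ≤ cL₂⁻¹ := (one_le_inv₀ hcL₂0).2 hcL₂1.le
  simp only [hp₁, hq₁, hp₂, hq₂, ite_truncation_eq, ite_lower_truncation_eq hcL₁0,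
    ite_lower_truncation_eq hcL₂0, Finset.mul_sum]
  constructor
  · refine Finset.sum_le_sum fun x hx => ?_
    have hqp : q x ≤ p x := (mem_filter.1 hx).2
    rw [min_eq_left (hqp.trans (le_mul_of_one_le_left (hp0 x) hI₁)),
      min_eq_left (hqp.trans (le_mul_of_one_le_left (hp0 x) hI₂))]
    exact sq_sqrt_sub_sqrt_scaled_le
      (le_min hqp (le_mul_of_one_le_left (hq0 x) hcU₂.le)) (hU x) hs ht0 ht
  · refine Finset.sum_le_sum fun x hx => ?_
    have hpq : p x ≤ q x := (mem_filter.1 hx).2.le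
    rw [min_eq_left (hpq.trans (le_mul_of_one_le_left (hq0 x) hcU₁.le)),
      min_eq_left (hpq.trans (le_mul_of_one_le_left (hq0 x) hcU₂.le)),
      sub_sq_comm, sub_sq_comm √((1 + ε₁) * p x)]
    exact sq_sqrt_sub_sqrt_scaled_le
      (le_min hpq (le_mul_of_one_le_left (hp0 x) hI₂)) (hL x) hs ht0 ht

end
end
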